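/- For positive integers 𝐀, 𝐁, 𝐂 with 𝐀 ≥ max{𝐁, 𝐂} and 𝐀 ≤ 𝐁·𝐂, there exist finite sets A, B, C ⊂ [0,1] with |A| ≍ 𝐀, |B| ≍ 𝐁, |C| ≍ 𝐂 such that |A + cB| ≲ √(𝐀𝐁𝐂) for every c ∈ C, and moreover A is 1/𝐀-separated with ≍ 𝐀 elements, B is 1/𝐁-separated with ≍ 𝐁 elements, and C has 1/𝐂-covering number ≍ 𝐂. -/

import Mathlib

open Pointwise

/-- The `ρ`-covering number of `X ⊂ ℝ`. -/
noncomputable def covN (ρ : ℝ) (X : Set ℝ) : ℕ :=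
  sInf {k : ℕ | ∃ s : Finset ℝ, s.card = k ∧ X ⊆ ⋃ p ∈ s, Set.Icc p (p + ρ)}

open Finset in
/-- A partial-sum bound for `∑ 1 / g ^ 2`, starting from `g = 2`. -/
theorem sum_Icc_two_inv_sq_le (n : ℕ) :
    ∑ g ∈ Icc 2 n, 1 / (g : ℝ) ^ 2 ≤ 3 / 4 := by
  have key : ∀ m : ℕ, ∑ g ∈ Icc 2 (m + 2), 1 / (g : ℝ) ^ 2 ≤ 3 / 4 - 1 / ((m : ℝ) + 2) := by
    intro m
    induction m with
    | zero => norm_num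
    | succ m ih =>
      rw [show m + 1 + 2 = (m + 2) + 1 by ring, Finset.sum_Icc_succ_top (by omega)]
      have h : 1 / ((m : ℝ) + 3) ^ 2 ≤ 1 / ((m : ℝ) + 2) - 1 / ((m : ℝ) + 3) := by
        rw [div_sub_div _ _ (by positivity) (by positivity),
          div_le_div_iff₀ (by positivity) (by positivity)]
        have : (0 : ℝ) ≤ m := m.cast_nonneg
        nlinarith [sq_nonneg ((m : ℝ) + 3)]
      push_cast
      rw [show (m : ℝ) + 2 + 1 = m + 3 by ring, show (m : ℝ) + 1 + 2 = m + 3 by ring]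
      linarith
  rcases Nat.lt_or_ge n 2 with h | h
  · rw [Finset.Icc_eq_empty (by omega)]
    norm_num
  · obtain ⟨m, rfl⟩ := Nat.exists_eq_add_of_le' h
    have : (0 : ℝ) ≤ 1 / ((m : ℝ) + 2) := by positivity
    linarith [key m]

/-- The pairs of coprime positive integers, both at most `N`. -/
def coprimePairs (N : ℕ) : Finset (ℕ × ℕ) :=
  (Finset.Ioc 0 N ×ˢ Finset.Ioc 0 N).filter fun p => Nat.Coprime p.1 p.2

theorem card_coprimePairs_le (N : ℕ) : (coprimePairs N).card ≤ N ^ 2 := by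
  refine (Finset.card_filter_le _ _).trans ?_
  simp [sq]

open Finset in
theorem sq_le_four_mul_card_coprimePairs (N : ℕ) :
    (N : ℝ) ^ 2 ≤ 4 * (coprimePairs N).card := by
  have hcompl : ((Ioc 0 N ×ˢ Ioc 0 N).filter fun p : ℕ × ℕ => ¬ Nat.Coprime p.1 p.2) ⊆
      (Icc 2 N).biUnion fun g =>
        ((Ioc 0 N).filter (g ∣ ·)) ×ˢ ((Ioc 0 N).filter (g ∣ ·)) := by
    rintro ⟨u, v⟩ h
    simp only [mem_filter, mem_product, mem_Ioc] at h
    obtain ⟨⟨⟨hu, huN⟩, hv, hvN⟩, hc⟩ := h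
    have hpos : 0 < Nat.gcd u v := Nat.gcd_pos_of_pos_left v hu
    have hle : Nat.gcd u v ≤ u := Nat.gcd_le_left v hu
    have hne : Nat.gcd u v ≠ 1 := hc
    simp only [mem_biUnion, mem_product, mem_filter, mem_Ioc, mem_Icc]
    exact ⟨Nat.gcd u v, ⟨by omega, by omega⟩, ⟨⟨hu, huN⟩, Nat.gcd_dvd_left u v⟩,
      ⟨hv, hvN⟩, Nat.gcd_dvd_right u v⟩
  have hcard : (((Ioc 0 N ×ˢ Ioc 0 N).filter
      fun p : ℕ × ℕ => ¬ Nat.Coprime p.1 p.2).card : ℝ) ≤ 3 / 4 * (N : ℝ) ^ 2 := by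
    calc _ ≤ ((∑ g ∈ Icc 2 N, (N / g) * (N / g) : ℕ) : ℝ) := by
          have := (card_le_card hcompl).trans card_biUnion_le
          simp only [card_product, Nat.Ioc_filter_dvd_card_eq_div] at this
          exact_mod_cast this
      _ ≤ ∑ g ∈ Icc 2 N, (N : ℝ) ^ 2 * (1 / (g : ℝ) ^ 2) := by
          push_cast
          refine sum_le_sum fun g _ => ?_
          have h : ((N / g : ℕ) : ℝ) ≤ N / g := Nat.cast_div_le
          calc ((N / g : ℕ) : ℝ) * ((N / g : ℕ) : ℝ) ≤ (N / g : ℝ) * (N / g : ℝ) := by gcongr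
            _ = _ := by ring
      _ ≤ _ := by
          rw [← mul_sum]
          nlinarith [sum_Icc_two_inv_sq_le N, sq_nonneg (N : ℝ)]
  have hsum := card_filter_add_card_filter_not (s := Ioc 0 N ×ˢ Ioc 0 N)
    (fun p : ℕ × ℕ => Nat.Coprime p.1 p.2)
  rw [card_product, Nat.card_Ioc, Nat.sub_zero] at hsum
  have hsum' : ((coprimePairs N).card : ℝ) + (((Ioc 0 N ×ˢ Ioc 0 N).filter
      fun p : ℕ × ℕ => ¬ Nat.Coprime p.1 p.2).card : ℝ) = N * N := by
    exact_mod_cast hsum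
  nlinarith

/-- The rationals `(k + u / (u + v)) / q` with `k < q` and `u, v ≤ N` coprime. -/
noncomputable def ratioSet (q N : ℕ) : Finset ℝ :=
  (Finset.range q ×ˢ coprimePairs N).image fun t =>
    ((t.1 : ℝ) + t.2.1 / ((t.2.1 : ℝ) + t.2.2)) / q

theorem card_ratioSet (q N : ℕ) : (ratioSet q N).card = q * (coprimePairs N).card := by
  unfold ratioSet
  rw [Finset.card_image_of_injOn, Finset.card_product, Finset.card_range]
  rintro ⟨k, u, v⟩ h ⟨k', u', v'⟩ h' heq
  simp only [coprimePairs, Finset.coe_product, Finset.coe_filter, Finset.mem_product,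
    Set.mem_prod, Finset.mem_coe, Finset.mem_range, Set.mem_ofPred_eq, Finset.mem_Ioc] at h h'
  obtain ⟨hk, ⟨⟨hu, -⟩, hv, -⟩, hc⟩ := h
  obtain ⟨-, ⟨⟨hu', -⟩, hv', -⟩, hc'⟩ := h'
  have hq : (q : ℝ) ≠ 0 := by
    have : q ≠ 0 := by omega
    exact_mod_cast this
  have hu0 : (0 : ℝ) < u := by exact_mod_cast hu
  have hv0 : (0 : ℝ) < v := by exact_mod_cast hv
  have hu0' : (0 : ℝ) < u' := by exact_mod_cast hu'
  have hv0' : (0 : ℝ) < v' := by exact_mod_cast hv'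
  have heq' : (k : ℝ) + u / ((u : ℝ) + v) = k' + u' / ((u' : ℝ) + v') := by
    simpa [div_left_inj' hq] using heq
  have hf : (u : ℝ) / (u + v) < 1 := by
    rw [div_lt_one (by positivity)]; linarith
  have hf' : (u' : ℝ) / (u' + v') < 1 := by
    rw [div_lt_one (by positivity)]; linarith
  have hp : 0 < (u : ℝ) / (u + v) := by positivity
  have hp' : 0 < (u' : ℝ) / (u' + v') := by positivity
  have hkk : k = k' := by
    have h1 : (k : ℝ) < k' + 1 := by linarith
    have h2 : (k' : ℝ) < k + 1 := by linarith
    have h1' : k < k' + 1 := by exact_mod_cast h1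
    have h2' : k' < k + 1 := by exact_mod_cast h2
    omega
  subst hkk
  have hfrac : (u : ℝ) / (u + v) = u' / (u' + v') := by linarith
  rw [div_eq_div_iff (by positivity) (by positivity)] at hfrac
  have hcross : u * v' = u' * v := by
    have : (u : ℝ) * v' = u' * v := by linarith
    exact_mod_cast this
  have huu : u = u' := Nat.dvd_antisymm
    (hc.dvd_of_dvd_mul_right (hcross ▸ Dvd.intro _ rfl))
    (hc'.dvd_of_dvd_mul_right (hcross ▸ Dvd.intro _ rfl))
  subst huu
  have hvv : v' = v := Nat.eq_of_mul_eq_mul_left hu hcross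
  rw [hvv]

/-- Elements of `ratioSet q N` are rationals in `[0, 1]` with a denominator `q * n`, `n ≤ 2 * N`. -/
theorem exists_eq_div_of_mem_ratioSet {q N : ℕ} {x : ℝ} (hx : x ∈ ratioSet q N) :
    ∃ w n : ℕ, 0 < n ∧ n ≤ 2 * N ∧ w ≤ q * n ∧ x = w / (q * n) := by
  simp only [ratioSet, coprimePairs, Finset.mem_image, Finset.mem_product, Finset.mem_filter,
    Finset.mem_Ioc, Finset.mem_range] at hx
  obtain ⟨⟨k, u, v⟩, ⟨hk, ⟨⟨hu, huN⟩, hv, hvN⟩, -⟩, rfl⟩ := hx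
  dsimp only at *
  refine ⟨k * (u + v) + u, u + v, by omega, by omega, ?_, ?_⟩
  · calc k * (u + v) + u ≤ (k + 1) * (u + v) := by nlinarith
      _ ≤ q * (u + v) := Nat.mul_le_mul_right _ hk
  · have hu0 : (0 : ℝ) < u := by exact_mod_cast hu
    have hq : (0 : ℝ) < q := by
      have : 0 < q := by omega
      exact_mod_cast this
    push_cast
    field_simp

theorem one_le_mul_abs_sub_of_mem_ratioSet {q N : ℕ} {x y : ℝ} (hx : x ∈ ratioSet q N)
    (hy : y ∈ ratioSet q N) (hxy : x ≠ y) : 1 ≤ 4 * (q * (N : ℝ) ^ 2) * |x - y| := by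
  obtain ⟨w, n, hn, hnN, hw, rfl⟩ := exists_eq_div_of_mem_ratioSet hx
  obtain ⟨w', n', hn', hnN', hw', rfl⟩ := exists_eq_div_of_mem_ratioSet hy
  have hn0 : (0 : ℝ) < n := by exact_mod_cast hn
  have hn0' : (0 : ℝ) < n' := by exact_mod_cast hn'
  have hq : (0 : ℝ) < q := by
    rcases Nat.eq_zero_or_pos q with rfl | h
    · simp at hxy
    · exact_mod_cast h
  have hdiff : (w : ℝ) / (q * n) - w' / (q * n') =
      ((w * n' - w' * n : ℤ) : ℝ) / (q * n * n') := by
    push_cast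
    field_simp
  have hne : (w * n' - w' * n : ℤ) ≠ 0 := by
    intro h
    rw [h, Int.cast_zero, zero_div, sub_eq_zero] at hdiff
    exact hxy hdiff
  have hone : (1 : ℝ) ≤ |((w * n' - w' * n : ℤ) : ℝ)| := by
    exact_mod_cast Int.one_le_abs hne
  have hprod : (n : ℝ) * n' ≤ (2 * N) * (2 * N) := by
    have h1 : (n : ℝ) ≤ 2 * N := by exact_mod_cast hnN
    have h2 : (n' : ℝ) ≤ 2 * N := by exact_mod_cast hnN'
    gcongr
  rw [hdiff, abs_div, abs_of_pos (show (0 : ℝ) < q * n * n' by positivity), mul_div_assoc',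
    le_div_iff₀ (by positivity)]
  calc 1 * ((q : ℝ) * n * n') = q * (n * n') * 1 := by ring
    _ ≤ q * ((2 * N) * (2 * N)) * |((w * n' - w' * n : ℤ) : ℝ)| := by gcongr
    _ = _ := by ring

theorem covN_le_card {ρ : ℝ} (hρ : 0 ≤ ρ) (C : Finset ℝ) : covN ρ (C : Set ℝ) ≤ C.card := by
  refine Nat.sInf_le ⟨C, rfl, fun x hx => ?_⟩
  simp only [Set.mem_iUnion]
  exact ⟨x, hx, le_rfl, by linarith⟩

/-- A finite set separated at scale `ρ / 4` has at most five points in an interval of length `ρ`,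
so its cardinality is controlled by its covering number. -/
theorem card_le_five_mul_covN {R : ℝ} (hR : 0 < R) (C : Finset ℝ)
    (hC : ∀ x ∈ C, ∀ y ∈ C, x ≠ y → 1 ≤ 4 * R * |x - y|) :
    C.card ≤ 5 * covN (1 / R) (C : Set ℝ) := by
  have hmem : covN (1 / R) (C : Set ℝ) ∈
      {k : ℕ | ∃ s : Finset ℝ, s.card = k ∧ (C : Set ℝ) ⊆ ⋃ p ∈ s, Set.Icc p (p + 1 / R)} := by
    refine Nat.sInf_mem ⟨C.card, C, rfl, fun x hx => ?_⟩
    simp only [Set.mem_iUnion]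
    exact ⟨x, hx, le_rfl, by linarith [one_div_pos.mpr hR]⟩
  obtain ⟨s, hs, hcov⟩ := hmem
  rw [← hs]
  have hsub : C ⊆ s.biUnion fun p => C.filter fun x => x ∈ Set.Icc p (p + 1 / R) := by
    intro x hx
    have := hcov hx
    simp only [Set.mem_iUnion] at this
    obtain ⟨p, hp, hxp⟩ := this
    exact Finset.mem_biUnion.mpr ⟨p, hp, Finset.mem_filter.mpr ⟨hx, hxp⟩⟩
  rw [mul_comm]
  refine (Finset.card_le_card hsub).trans (Finset.card_biUnion_le_card_mul _ _ _ fun p _ => ?_)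
  rw [← Finset.card_range 5]
  refine Finset.card_le_card_of_injOn (fun x => ⌊(x - p) * (4 * R)⌋₊) ?_ ?_
  · intro x hx
    obtain ⟨-, hp, hpR⟩ := Finset.mem_filter.mp hx
    refine Finset.mem_coe.mpr (Finset.mem_range.mpr ?_)
    have h4 : (x - p) * (4 * R) ≤ 4 := by
      calc (x - p) * (4 * R) ≤ (1 / R) * (4 * R) := by gcongr; linarith
        _ = 4 := by field_simp
    rw [Nat.floor_lt (mul_nonneg (by linarith) (by positivity))]
    push_cast
    linarith
  · intro x hx y hy hxy
    obtain ⟨hxC, hpx, -⟩ := Finset.mem_filter.mp hx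
    obtain ⟨hyC, hpy, -⟩ := Finset.mem_filter.mp hy
    dsimp only at hxy
    by_contra hne
    have hsep := hC x hxC y hyC hne
    have hx0 : 0 ≤ (x - p) * (4 * R) := mul_nonneg (by linarith) (by positivity)
    have hy0 : 0 ≤ (y - p) * (4 * R) := mul_nonneg (by linarith) (by positivity)
    have hx1 := Nat.floor_le hx0
    have hx2 := Nat.lt_floor_add_one ((x - p) * (4 * R))
    have hy1 := Nat.floor_le hy0
    have hy2 := Nat.lt_floor_add_one ((y - p) * (4 * R))
    rw [hxy] at hx1 hx2
    have habs : |(x - y) * (4 * R)| < 1 := by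
      rw [abs_lt]; constructor <;> linarith
    rw [abs_mul, abs_of_pos (show 0 < 4 * R by positivity)] at habs
    linarith

/-- The arithmetic progression `0, d, 2 d, …` with `m` terms. -/
noncomputable def progression (d : ℝ) (m : ℕ) : Finset ℝ :=
  (Finset.range m).image fun i : ℕ => (i : ℝ) * d

theorem card_progression {d : ℝ} (hd : d ≠ 0) (m : ℕ) : (progression d m).card = m := by
  rw [progression, Finset.card_image_of_injective, Finset.card_range]
  intro i j hij
  exact_mod_cast mul_right_cancel₀ hd hij

theorem progression_subset_Icc {d : ℝ} (hd : 0 ≤ d) {m : ℕ} (hm : m * d ≤ 1) :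
    (progression d m : Set ℝ) ⊆ Set.Icc 0 1 := by
  intro x hx
  obtain ⟨i, hi, rfl⟩ := Finset.mem_image.mp (Finset.mem_coe.mp hx)
  have him : (i : ℝ) ≤ m := by exact_mod_cast (Finset.mem_range.mp hi).le
  exact ⟨by positivity, (mul_le_mul_of_nonneg_right him hd).trans hm⟩

theorem le_abs_sub_of_mem_progression {d : ℝ} (hd : 0 ≤ d) {m : ℕ} {x y : ℝ}
    (hx : x ∈ progression d m) (hy : y ∈ progression d m) (hxy : x ≠ y) : d ≤ |x - y| := by
  obtain ⟨i, -, rfl⟩ := Finset.mem_image.mp hx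
  obtain ⟨j, -, rfl⟩ := Finset.mem_image.mp hy
  have hne : (i - j : ℤ) ≠ 0 := by
    intro h
    have : i = j := by omega
    exact hxy (by rw [this])
  have hone : (1 : ℝ) ≤ |(i : ℝ) - j| := by exact_mod_cast Int.one_le_abs hne
  rw [← sub_mul, abs_mul, abs_of_nonneg hd]
  exact le_mul_of_one_le_left hd hone

/-- Along a dilate from `ratioSet`, the sumset lies in a progression with gap `1 / (n * a)`. -/
theorem card_image_add_mul_progression_le {a b q N : ℕ} (ha : 0 < a) (hqb : q * b ≤ a) (hq : 0 < q)
    {c : ℝ} (hc : c ∈ ratioSet q N) :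
    ((progression (1 / a) a ×ˢ progression (q / a) b).image fun p => p.1 + c * p.2).card
      ≤ 4 * (N * a) := by
  obtain ⟨w, n, hn, hnN, hw, rfl⟩ := exists_eq_div_of_mem_ratioSet hc
  have ha0 : (0 : ℝ) < a := by exact_mod_cast ha
  have hn0 : (0 : ℝ) < n := by exact_mod_cast hn
  have hq0 : (0 : ℝ) < q := by exact_mod_cast hq
  have hsub : ((progression (1 / a) a ×ˢ progression (q / a) b).image
      fun p => p.1 + (w : ℝ) / (q * n) * p.2) ⊆ progression (1 / (n * a)) (2 * (n * a)) := by
    intro z hz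
    obtain ⟨⟨x, y⟩, hxy, rfl⟩ := Finset.mem_image.mp hz
    obtain ⟨hx, hy⟩ := Finset.mem_product.mp hxy
    obtain ⟨i, hi, rfl⟩ := Finset.mem_image.mp hx
    obtain ⟨j, hj, rfl⟩ := Finset.mem_image.mp hy
    refine Finset.mem_image.mpr ⟨n * i + w * j, Finset.mem_range.mpr ?_, ?_⟩
    · have h1 : n * i < n * a := Nat.mul_lt_mul_of_pos_left (Finset.mem_range.mp hi) hn
      have h2 : w * j ≤ n * a := by
        calc w * j ≤ (q * n) * b := Nat.mul_le_mul hw (Finset.mem_range.mp hj).le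
          _ = n * (q * b) := by ring
          _ ≤ n * a := Nat.mul_le_mul_left _ hqb
      omega
    · push_cast
      field_simp
  calc _ ≤ 2 * (n * a) := (Finset.card_le_card hsub).trans
        (card_progression (by positivity) _).le
    _ ≤ 2 * (2 * N * a) := by gcongr
    _ = _ := by ring

/-- Sharpness construction: for positive integers `AA ≥ max{BB, CC}` with `AA ≤ BB·CC`,
there are sets `A, B, C ⊂ [0,1]` with `|A| ≍ AA`, `|B| ≍ BB`, `|C|_{1/CC} ≍ CC`,
`A` being `1/AA`-separated, `B` being `1/BB`-separated, and `|A + cB| ≲ √(AA·BB·CC)`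
for every `c ∈ C`. -/
theorem stmt5 :
    ∃ K : ℝ, 0 < K ∧ ∀ AA BB CC : ℕ, 0 < AA → 0 < BB → 0 < CC →
      BB ≤ AA → CC ≤ AA → AA ≤ BB * CC →
      ∃ A B C : Finset ℝ,
        (↑A ⊆ Set.Icc (0:ℝ) 1) ∧ (↑B ⊆ Set.Icc (0:ℝ) 1) ∧ (↑C ⊆ Set.Icc (0:ℝ) 1) ∧
        (AA : ℝ) / K ≤ A.card ∧ (A.card : ℝ) ≤ K * AA ∧
        (BB : ℝ) / K ≤ B.card ∧ (B.card : ℝ) ≤ K * BB ∧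
        (CC : ℝ) / K ≤ C.card ∧ (C.card : ℝ) ≤ K * CC ∧
        (∀ x ∈ A, ∀ y ∈ A, x ≠ y → 1 / (K * AA) ≤ |x - y|) ∧
        (∀ x ∈ B, ∀ y ∈ B, x ≠ y → 1 / (K * BB) ≤ |x - y|) ∧
        (CC : ℝ) / K ≤ (covN (1 / (CC : ℝ)) ↑C : ℝ) ∧
        ((covN (1 / (CC : ℝ)) ↑C : ℝ) ≤ K * CC) ∧
        (∀ c ∈ C,
          (((A ×ˢ B).image (fun p => p.1 + c * p.2)).card : ℝ)
            ≤ K * Real.sqrt ((AA : ℝ) * BB * CC)) := by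
  refine ⟨160, by norm_num, fun a b c ha hb hc hba hca habc => ?_⟩
  obtain ⟨q, hq⟩ : ∃ q, q = a / b := ⟨_, rfl⟩
  obtain ⟨N, hN⟩ : ∃ N, N = Nat.sqrt (b * c / a) := ⟨_, rfl⟩
  have hq1 : 0 < q := hq ▸ Nat.div_pos hba hb
  have hqb : q * b ≤ a := hq ▸ Nat.div_mul_le_self a b
  have haq : a ≤ 2 * (q * b) := by
    have : a < b * (a / b + 1) := Nat.lt_mul_div_succ a hb
    rw [← hq] at this
    nlinarith
  have hNa : N ^ 2 * a ≤ b * c := by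
    calc N ^ 2 * a ≤ b * c / a * a := Nat.mul_le_mul_right _ (hN ▸ Nat.sqrt_le' _)
      _ ≤ b * c := Nat.div_mul_le_self _ _
  have hN1 : 0 < N := hN ▸ Nat.sqrt_pos.mpr (Nat.div_pos habc ha)
  have hbcN : b * c ≤ 4 * N ^ 2 * a := by
    have h1 : b * c / a < (N + 1) ^ 2 := hN ▸ Nat.lt_succ_sqrt' _
    have h2 : b * c < (b * c / a + 1) * a := by
      rw [mul_comm (b * c / a + 1)]; exact Nat.lt_mul_div_succ _ ha
    have h3 : (N + 1) ^ 2 ≤ 4 * N ^ 2 := by nlinarith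
    exact h2.le.trans (Nat.mul_le_mul_right _ (by omega))
  have hqN : q * N ^ 2 ≤ c := by
    refine Nat.le_of_mul_le_mul_left ?_ (Nat.mul_pos ha hb)
    calc a * b * (q * N ^ 2) = (q * b) * (N ^ 2 * a) := by ring
      _ ≤ a * (b * c) := Nat.mul_le_mul hqb hNa
      _ = a * b * c := by ring
  have hcq : c ≤ 8 * (q * N ^ 2) := by
    refine Nat.le_of_mul_le_mul_left ?_ hb
    calc b * c ≤ 4 * N ^ 2 * a := hbcN
      _ ≤ 4 * N ^ 2 * (2 * (q * b)) := Nat.mul_le_mul_left _ haq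
      _ = b * (8 * (q * N ^ 2)) := by ring
  have ha0 : (0 : ℝ) < a := by exact_mod_cast ha
  have hb0 : (0 : ℝ) < b := by exact_mod_cast hb
  have hc0 : (0 : ℝ) < c := by exact_mod_cast hc
  have hq0 : (0 : ℝ) < q := by exact_mod_cast hq1
  have hqN' : (q : ℝ) * (N : ℝ) ^ 2 ≤ c := by exact_mod_cast hqN
  have hcq' : (c : ℝ) ≤ 8 * (q * (N : ℝ) ^ 2) := by exact_mod_cast hcq
  have hcardA : (progression (1 / (a : ℝ)) a).card = a := card_progression (by positivity) _
  have hcardB : (progression ((q : ℝ) / a) b).card = b := card_progression (by positivity) _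
  have hcardC : (ratioSet q N).card ≤ c := by
    rw [card_ratioSet]
    exact (Nat.mul_le_mul_left _ (card_coprimePairs_le N)).trans hqN
  have hcardC_lower : (c : ℝ) ≤ 32 * (ratioSet q N).card := by
    rw [card_ratioSet]
    push_cast
    have := mul_le_mul_of_nonneg_left (sq_le_four_mul_card_coprimePairs N) hq0.le
    linarith
  have hcov : (ratioSet q N).card ≤ 5 * covN (1 / (c : ℝ)) (ratioSet q N : Set ℝ) := by
    refine card_le_five_mul_covN hc0 _ fun x hx y hy hxy => ?_
    refine (one_le_mul_abs_sub_of_mem_ratioSet hx hy hxy).trans ?_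
    gcongr
  have hcov_upper := (covN_le_card (one_div_pos.mpr hc0).le (ratioSet q N)).trans hcardC
  have hcardC' : ((ratioSet q N).card : ℝ) ≤ c := by exact_mod_cast hcardC
  have hcov' : ((ratioSet q N).card : ℝ) ≤ 5 * (covN (1 / (c : ℝ)) (ratioSet q N : Set ℝ) : ℝ) := by
    exact_mod_cast hcov
  have hcov_upper' : (covN (1 / (c : ℝ)) (ratioSet q N : Set ℝ) : ℝ) ≤ c := by
    exact_mod_cast hcov_upper
  refine ⟨progression (1 / a) a, progression (q / a) b, ratioSet q N,
    progression_subset_Icc (by positivity) (by field_simp; rfl),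
    progression_subset_Icc (by positivity) ?_, ?_, ?_, ?_, ?_, ?_, ?_, ?_, ?_, ?_, ?_, ?_, ?_⟩
  · rw [mul_div_assoc', div_le_one ha0, mul_comm]
    exact_mod_cast hqb
  · intro x hx
    obtain ⟨w, n, hn, -, hw, rfl⟩ := exists_eq_div_of_mem_ratioSet (Finset.mem_coe.mp hx)
    have hn0 : (0 : ℝ) < n := by exact_mod_cast hn
    refine ⟨by positivity, ?_⟩
    rw [div_le_one (by positivity)]
    exact_mod_cast hw
  · rw [hcardA]; linarith
  · rw [hcardA]; linarith
  · rw [hcardB]; linarith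
  · rw [hcardB]; linarith
  · linarith
  · linarith
  · intro x hx y hy hxy
    refine le_trans ?_ (le_abs_sub_of_mem_progression (by positivity) hx hy hxy)
    exact one_div_le_one_div_of_le ha0 (by linarith)
  · intro x hx y hy hxy
    refine le_trans ?_ (le_abs_sub_of_mem_progression (by positivity) hx hy hxy)
    have haq' : (a : ℝ) ≤ 2 * (q * b) := by exact_mod_cast haq
    rw [div_le_div_iff₀ (by positivity) ha0]
    nlinarith [mul_pos hq0 hb0]
  · linarith
  · linarith
  · intro x hx
    have hcard := card_image_add_mul_progression_le ha hqb hq1 hx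
    have hcard' : (((progression (1 / a) a ×ˢ progression (q / a) b).image
        fun p => p.1 + x * p.2).card : ℝ) ≤ 4 * (N * a) := by exact_mod_cast hcard
    have hsqrt : (N : ℝ) * a ≤ Real.sqrt ((a : ℝ) * b * c) := by
      refine Real.le_sqrt_of_sq_le ?_
      have hNa' : (N : ℝ) ^ 2 * a ≤ b * c := by exact_mod_cast hNa
      calc ((N : ℝ) * a) ^ 2 = (a : ℝ) * ((N : ℝ) ^ 2 * a) := by ring
        _ ≤ (a : ℝ) * (b * c) := by gcongr
        _ = (a : ℝ) * b * c := by ring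
    linarith [Real.sqrt_nonneg ((a : ℝ) * b * c)]
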